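/- arXiv:2107.14102 — 6 statements merged into one kernel-verified Lean document; each statement's English description precedes it below -/
import Mathlib

section
/- Let s ∈ ℝ and let 0 < a₃ ≤ a₄ be real numbers. There exists a constant C > 0 depending only on s, a₃ and a₄ (and not on N) such that for every N ≥ 1, every λ ∈ ℝᴺ with a₃ ≤ λⱼ ≤ a₄ for all j, and every x ∈ ℝᴺ with ∑ⱼ xⱼ² = 1, one has (∑ⱼ λⱼ^{2s} xⱼ²)/(∑ⱼ λⱼ^{s} xⱼ²)² − 1 ≤ C · [ (∑ⱼ λⱼ² xⱼ²)/(∑ⱼ λⱼ xⱼ²)² − 1 ]. -/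
/-- A real power is Lipschitz on a compact interval of positive reals. -/
theorem exists_abs_rpow_sub_le (s : ℝ) {a b : ℝ} (ha : 0 < a) :
    ∃ L : ℝ, ∀ u ∈ Set.Icc a b, ∀ v ∈ Set.Icc a b, |u ^ s - v ^ s| ≤ L * |u - v| := by
  have hpos : ∀ t ∈ Set.Icc a b, t ≠ 0 := fun t ht => (ha.trans_le ht.1).ne'
  have hcont : ContinuousOn (fun t : ℝ => s * t ^ (s - 1)) (Set.Icc a b) :=
    continuousOn_const.mul (continuousOn_id.rpow_const fun t ht => Or.inl (hpos t ht))
  obtain ⟨L, hL⟩ := isCompact_Icc.exists_bound_of_continuousOn hcont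
  refine ⟨L, fun u hu v hv => ?_⟩
  exact (convex_Icc a b).norm_image_sub_le_of_norm_hasDerivWithin_le
    (fun t ht => (Real.hasDerivAt_rpow_const (Or.inl (hpos t ht))).hasDerivWithinAt) hL hv hu

/-- A real power is bounded below by a positive constant on a compact interval of positive
reals. -/
theorem exists_pos_le_rpow (s : ℝ) {a b : ℝ} (ha : 0 < a) (hab : a ≤ b) :
    ∃ c : ℝ, 0 < c ∧ ∀ u ∈ Set.Icc a b, c ≤ u ^ s := by
  have hcont : ContinuousOn (fun t : ℝ => t ^ s) (Set.Icc a b) :=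
    continuousOn_id.rpow_const fun t ht => Or.inl (ha.trans_le ht.1).ne'
  obtain ⟨t, ht, hmin⟩ := isCompact_Icc.exists_isMinOn (Set.nonempty_Icc.2 hab) hcont
  exact ⟨t ^ s, Real.rpow_pos_of_pos (ha.trans_le ht.1) s, fun u hu => hmin hu⟩

section WeightedMean

variable {ι : Type*} [Fintype ι] {p : ι → ℝ}

/-- The second moment about any point `k` in terms of the raw moments. -/
theorem sum_sub_sq_mul (hp : ∑ j, p j = 1) (f : ι → ℝ) (k : ℝ) :
    ∑ j, (f j - k) ^ 2 * p j = ∑ j, f j ^ 2 * p j - 2 * k * ∑ j, f j * p j + k ^ 2 := by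
  have h : ∀ j, (f j - k) ^ 2 * p j = f j ^ 2 * p j - 2 * k * (f j * p j) + k ^ 2 * p j :=
    fun j => by ring
  simp only [h, Finset.sum_add_distrib, Finset.sum_sub_distrib, ← Finset.mul_sum, hp, mul_one]

theorem le_sum_mul_of_le (hp0 : ∀ j, 0 ≤ p j) (hp : ∑ j, p j = 1) {f : ι → ℝ} {c : ℝ}
    (hf : ∀ j, c ≤ f j) : c ≤ ∑ j, f j * p j := by
  calc c = ∑ j, c * p j := by rw [← Finset.mul_sum, hp, mul_one]
    _ ≤ _ := Finset.sum_le_sum fun j _ => mul_le_mul_of_nonneg_right (hf j) (hp0 j)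

theorem sum_mul_le_of_le (hp0 : ∀ j, 0 ≤ p j) (hp : ∑ j, p j = 1) {f : ι → ℝ} {c : ℝ}
    (hf : ∀ j, f j ≤ c) : ∑ j, f j * p j ≤ c := by
  calc _ ≤ ∑ j, c * p j := Finset.sum_le_sum fun j _ => mul_le_mul_of_nonneg_right (hf j) (hp0 j)
    _ = c := by rw [← Finset.mul_sum, hp, mul_one]

/-- If `f` deviates from some `k` at most `L` times as much as `g` deviates from its mean, then
the variance of `f` is at most `L ^ 2` times the variance of `g`. -/
theorem variance_le_sq_mul_variance (hp0 : ∀ j, 0 ≤ p j) (hp : ∑ j, p j = 1) {f g : ι → ℝ}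
    {k L : ℝ} (h : ∀ j, |f j - k| ≤ L * |g j - ∑ i, g i * p i|) :
    ∑ j, f j ^ 2 * p j - (∑ j, f j * p j) ^ 2 ≤
      L ^ 2 * (∑ j, g j ^ 2 * p j - (∑ j, g j * p j) ^ 2) := by
  have hle : ∑ j, (f j - k) ^ 2 * p j ≤ L ^ 2 * ∑ j, (g j - ∑ i, g i * p i) ^ 2 * p j := by
    rw [Finset.mul_sum]
    refine Finset.sum_le_sum fun j _ => ?_
    rw [← mul_assoc]
    refine mul_le_mul_of_nonneg_right ?_ (hp0 j)
    simpa only [mul_pow, sq_abs] using pow_le_pow_left₀ (abs_nonneg _) (h j) 2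
  rw [sum_sub_sq_mul hp, sum_sub_sq_mul hp] at hle
  linarith [sq_nonneg (∑ j, f j * p j - k)]

end WeightedMean

/-- For `s ∈ ℝ` and `0 < a₃ ≤ a₄`, there is a constant `C > 0`
depending only on `s, a₃, a₄` (independent of `N`) such that for every `N ≥ 1`,
every `λ` with entries in `[a₃, a₄]` and every unit vector `x`,
`(∑ λⱼ^{2s} xⱼ²)/(∑ λⱼ^{s} xⱼ²)² − 1 ≤ C·[(∑ λⱼ² xⱼ²)/(∑ λⱼ xⱼ²)² − 1]`. -/
theorem stmt0 (s a₃ a₄ : ℝ) (ha₃ : 0 < a₃) (ha : a₃ ≤ a₄) :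
    ∃ C : ℝ, 0 < C ∧
      ∀ (N : ℕ), 1 ≤ N → ∀ (lam x : Fin N → ℝ),
        (∀ j, a₃ ≤ lam j ∧ lam j ≤ a₄) →
        (∑ j, x j ^ 2) = 1 →
        (∑ j, lam j ^ (2 * s) * x j ^ 2) / (∑ j, lam j ^ s * x j ^ 2) ^ 2 - 1 ≤
          C * ((∑ j, lam j ^ (2 : ℕ) * x j ^ 2) / (∑ j, lam j * x j ^ 2) ^ 2 - 1) := by
  obtain ⟨L, hL⟩ := exists_abs_rpow_sub_le s (b := a₄) ha₃
  obtain ⟨c, hc, hcs⟩ := exists_pos_le_rpow s ha₃ ha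
  refine ⟨L ^ 2 * a₄ ^ 2 / c ^ 2 + 1, by positivity, fun N _ lam x hlam hx => ?_⟩
  have hx0 : ∀ j, 0 ≤ x j ^ 2 := fun j => sq_nonneg _
  have hpow : ∀ j, lam j ^ (2 * s) = (lam j ^ s) ^ 2 := fun j => by
    rw [mul_comm, Real.rpow_mul (ha₃.le.trans (hlam j).1), Real.rpow_two]
  simp only [hpow]
  have hm₃ := le_sum_mul_of_le hx0 hx fun j => (hlam j).1
  have hm₄ := sum_mul_le_of_le hx0 hx fun j => (hlam j).2
  have hF := le_sum_mul_of_le hx0 hx fun j => hcs (lam j) (hlam j)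
  have hvar := variance_le_sq_mul_variance hx0 hx fun j => hL (lam j) (hlam j) _ ⟨hm₃, hm₄⟩
  have hnonneg := sum_sub_sq_mul hx lam (∑ j, lam j * x j ^ 2)
  have hsum : 0 ≤ ∑ j, (lam j - ∑ i, lam i * x i ^ 2) ^ 2 * x j ^ 2 :=
    Finset.sum_nonneg fun j _ => by positivity
  rw [hnonneg] at hsum
  set m := ∑ j, lam j * x j ^ 2
  set F := ∑ j, lam j ^ s * x j ^ 2
  set V := ∑ j, lam j ^ 2 * x j ^ 2
  set W := ∑ j, (lam j ^ s) ^ 2 * x j ^ 2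
  have hm : 0 < m := ha₃.trans_le hm₃
  have hF0 : 0 < F := hc.trans_le hF
  have hV : 0 ≤ V - m ^ 2 := by linarith
  have hB : 0 ≤ V / m ^ 2 - 1 := by
    rw [div_sub_one (by positivity)]
    positivity
  calc W / F ^ 2 - 1 = (W - F ^ 2) / F ^ 2 := by rw [div_sub_one (by positivity)]
    _ ≤ L ^ 2 * (V - m ^ 2) / F ^ 2 := by gcongr
    _ ≤ L ^ 2 * (V - m ^ 2) / c ^ 2 := by gcongr
    _ = L ^ 2 * m ^ 2 / c ^ 2 * (V / m ^ 2 - 1) := by field_simp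
    _ ≤ L ^ 2 * a₄ ^ 2 / c ^ 2 * (V / m ^ 2 - 1) := by gcongr
    _ ≤ (L ^ 2 * a₄ ^ 2 / c ^ 2 + 1) * (V / m ^ 2 - 1) := by linarith
end

section
/- Let s ∈ ℝ, let 0 < a₃ ≤ a₄, let N ≥ 1, and let C̃ > 0. There exists a constant c > 0 depending only on s, a₃, a₄, N and C̃ such that the following holds: for every real orthogonal N×N matrix P and every λ ∈ ℝᴺ with a₃ ≤ λⱼ ≤ a₄ for all j, set L = Pᵀ·diag(λ₁,…,λ_N)·P and L^{(s)} = Pᵀ·diag(λ₁^{s},…,λ_N^{s})·P; then for every index i, if L_{ii} ≥ c · ∑_{j ≠ i} |L_{ij}|, then (L^{(s)})_{ii} ≥ C̃ · ∑_{j ≠ i} |(L^{(s)})_{ij}|. -/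
open Matrix

namespace Matrix

variable {n : Type*} [Fintype n] [DecidableEq n] {P : Matrix n n ℝ}

theorem transpose_mul_diagonal_mul_apply (P : Matrix n n ℝ) (g : n → ℝ) (i j : n) :
    (Pᵀ * diagonal g * P) i j = ∑ k, P k i * g k * P k j := by
  rw [mul_apply]
  simp [mul_diagonal]

theorem sum_mul_of_transpose_mul_self (hP : Pᵀ * P = 1) (i j : n) :
    ∑ k, P k i * P k j = if i = j then 1 else 0 := by
  simpa [mul_apply, one_apply] using congrFun₂ hP i j

theorem abs_apply_le_one_of_transpose_mul_self (hP : Pᵀ * P = 1) (i j : n) : |P i j| ≤ 1 := by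
  have h := sum_mul_of_transpose_mul_self hP j j
  rw [if_pos rfl] at h
  rw [abs_le_one_iff_mul_self_le_one, ← h]
  exact Finset.single_le_sum (f := fun k => P k j * P k j)
    (fun k _ => mul_self_nonneg _) (Finset.mem_univ i)

/-- A diagonal entry of `Pᵀ * diagonal g * P` is a weighted mean of the entries of `g`. -/
theorem transpose_mul_diagonal_mul_apply_self_mem_Icc (hP : Pᵀ * P = 1) {g : n → ℝ} {a b : ℝ}
    (hg : ∀ k, g k ∈ Set.Icc a b) (i : n) : (Pᵀ * diagonal g * P) i i ∈ Set.Icc a b := by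
  have h := sum_mul_of_transpose_mul_self hP i i
  rw [if_pos rfl] at h
  rw [transpose_mul_diagonal_mul_apply]
  constructor
  · calc a = ∑ k, a * (P k i * P k i) := by rw [← Finset.mul_sum, h, mul_one]
      _ ≤ ∑ k, P k i * g k * P k i := Finset.sum_le_sum fun k _ => by
        nlinarith [mul_le_mul_of_nonneg_right (hg k).1 (mul_self_nonneg (P k i))]
  · calc ∑ k, P k i * g k * P k i
        ≤ ∑ k, b * (P k i * P k i) := Finset.sum_le_sum fun k _ => by
          nlinarith [mul_le_mul_of_nonneg_right (hg k).2 (mul_self_nonneg (P k i))]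
      _ = b := by rw [← Finset.mul_sum, h, mul_one]

/-- Componentwise residual bound for the approximate eigenpair `(L i i, eᵢ)` of
`L = Pᵀ * diagonal g * P`, in the eigenbasis given by the rows of `P`. -/
theorem abs_mul_sub_diag_le_sum (hP : Pᵀ * P = 1) (hP' : P * Pᵀ = 1) (g : n → ℝ) (k i : n) :
    |P k i * (g k - (Pᵀ * diagonal g * P) i i)| ≤
      ∑ j ∈ Finset.univ.erase i, |(Pᵀ * diagonal g * P) i j| := by
  set L := Pᵀ * diagonal g * P with hL
  have hsymm : ∀ a b, L a b = L b a := fun a b => by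
    simp only [hL, transpose_mul_diagonal_mul_apply]
    exact Finset.sum_congr rfl fun _ _ => by ring
  have hPL : P * L = diagonal g * P := by
    rw [hL, Matrix.mul_assoc, ← Matrix.mul_assoc P, hP', Matrix.one_mul]
  have hentry : ∑ j, P k j * L j i = g k * P k i := by
    rw [← mul_apply, hPL, diagonal_mul]
  rw [← Finset.add_sum_erase _ _ (Finset.mem_univ i)] at hentry
  have hres : P k i * (g k - L i i) = ∑ j ∈ Finset.univ.erase i, P k j * L j i := by
    linarith
  rw [hres]
  refine (Finset.abs_sum_le_sum_abs _ _).trans (Finset.sum_le_sum fun j _ => ?_)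
  rw [abs_mul, hsymm i j]
  exact mul_le_of_le_one_left (abs_nonneg _) (abs_apply_le_one_of_transpose_mul_self hP k j)

/-- Off-diagonal entries of `f(L)` are controlled by the off-diagonal row sum of `L`
when `f` is Lipschitz on an interval containing the spectrum. -/
theorem sum_abs_offDiag_comp_le (hP : Pᵀ * P = 1) (hP' : P * Pᵀ = 1) {g : n → ℝ} {a b K : ℝ}
    (hg : ∀ k, g k ∈ Set.Icc a b) {f : ℝ → ℝ} (hK : 0 ≤ K)
    (hf : ∀ x ∈ Set.Icc a b, ∀ y ∈ Set.Icc a b, |f x - f y| ≤ K * |x - y|) (i : n) :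
    ∑ j ∈ Finset.univ.erase i, |(Pᵀ * diagonal (fun k => f (g k)) * P) i j| ≤
      (Fintype.card n : ℝ) ^ 2 * K *
        ∑ j ∈ Finset.univ.erase i, |(Pᵀ * diagonal g * P) i j| := by
  set d := (Pᵀ * diagonal g * P) i i with hd
  set R := ∑ j ∈ Finset.univ.erase i, |(Pᵀ * diagonal g * P) i j| with hR
  have hR0 : 0 ≤ R := Finset.sum_nonneg fun _ _ => abs_nonneg _
  have hdmem : d ∈ Set.Icc a b := transpose_mul_diagonal_mul_apply_self_mem_Icc hP hg i
  have hterm (k j : n) : |P k i * (f (g k) - f d) * P k j| ≤ K * R := by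
    calc |P k i * (f (g k) - f d) * P k j|
        ≤ |P k i * (f (g k) - f d)| := by
          rw [abs_mul _ (P k j)]
          exact mul_le_of_le_one_right (abs_nonneg _)
            (abs_apply_le_one_of_transpose_mul_self hP k j)
      _ ≤ |P k i| * (K * |g k - d|) := by
          rw [abs_mul]
          exact mul_le_mul_of_nonneg_left (hf _ (hg k) _ hdmem) (abs_nonneg _)
      _ = K * |P k i * (g k - d)| := by rw [abs_mul]; ring
      _ ≤ K * R := mul_le_mul_of_nonneg_left (abs_mul_sub_diag_le_sum hP hP' g k i) hK
  have hentry (j : n) (hj : j ∈ Finset.univ.erase i) :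
      |(Pᵀ * diagonal (fun k => f (g k)) * P) i j| ≤ Fintype.card n * (K * R) := by
    have h0 := sum_mul_of_transpose_mul_self hP i j
    rw [if_neg (Finset.ne_of_mem_erase hj).symm] at h0
    have hshift : ∑ k, P k i * f (g k) * P k j = ∑ k, P k i * (f (g k) - f d) * P k j := by
      rw [← sub_eq_zero, ← Finset.sum_sub_distrib, ← mul_zero (f d), ← h0, Finset.mul_sum]
      exact Finset.sum_congr rfl fun _ _ => by ring
    rw [transpose_mul_diagonal_mul_apply, hshift]
    refine (Finset.abs_sum_le_sum_abs _ _).trans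
      ((Finset.sum_le_card_nsmul _ _ _ fun k _ => hterm k j).trans_eq ?_)
    rw [nsmul_eq_mul, Finset.card_univ]
  refine (Finset.sum_le_sum hentry).trans ?_
  rw [Finset.sum_const, nsmul_eq_mul]
  have hcard : ((Finset.univ.erase i).card : ℝ) ≤ Fintype.card n := by
    exact_mod_cast Finset.card_le_univ _
  calc ((Finset.univ.erase i).card : ℝ) * (Fintype.card n * (K * R))
      ≤ Fintype.card n * (Fintype.card n * (K * R)) := by gcongr
    _ = (Fintype.card n : ℝ) ^ 2 * K * R := by ring

end Matrix

theorem Real.exists_abs_rpow_sub_rpow_le (s : ℝ) {a b : ℝ} (ha : 0 < a) :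
    ∃ K : ℝ, 0 ≤ K ∧ ∀ x ∈ Set.Icc a b, ∀ y ∈ Set.Icc a b,
      |x ^ s - y ^ s| ≤ K * |x - y| := by
  have hne (x : ℝ) (hx : x ∈ Set.Icc a b) : x ≠ 0 := (ha.trans_le hx.1).ne'
  have hcont : ContinuousOn (fun x : ℝ => s * x ^ (s - 1)) (Set.Icc a b) :=
    continuousOn_const.mul (continuousOn_id.rpow_const fun x hx => Or.inl (hne x hx))
  obtain ⟨K, hK⟩ := isCompact_Icc.exists_bound_of_continuousOn hcont
  refine ⟨max K 0, le_max_right _ _, fun x hx y hy => ?_⟩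
  exact (convex_Icc a b).norm_image_sub_le_of_norm_hasDerivWithin_le
    (fun z hz => (Real.hasDerivAt_rpow_const (p := s) (Or.inl (hne z hz))).hasDerivWithinAt)
    (fun z hz => (hK z hz).trans (le_max_left _ _)) hy hx

/-- for `s ∈ ℝ`, `0 < a₃ ≤ a₄`, `N ≥ 1` and `C̃ > 0` there is
`c > 0` depending only on `s, a₃, a₄, N, C̃` such that for every orthogonal
`P`, every `λ` with entries in `[a₃, a₄]` (with `L = Pᵀ diag(λ) P` and
`L^{(s)} = Pᵀ diag(λ^s) P`) and every `i`: if `L_{ii} ≥ c·∑_{j≠i} |L_{ij}|`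
then `(L^{(s)})_{ii} ≥ C̃·∑_{j≠i} |(L^{(s)})_{ij}|`. -/
theorem stmt3 (s a₃ a₄ : ℝ) (ha₃ : 0 < a₃) (ha : a₃ ≤ a₄) (N : ℕ) (hN : 1 ≤ N)
    (Ct : ℝ) (hCt : 0 < Ct) :
    ∃ c : ℝ, 0 < c ∧
      ∀ (P : Matrix (Fin N) (Fin N) ℝ), Pᵀ * P = 1 → P * Pᵀ = 1 →
      ∀ lam : Fin N → ℝ, (∀ j, a₃ ≤ lam j ∧ lam j ≤ a₄) →
      ∀ i : Fin N,
        ((Pᵀ * Matrix.diagonal lam * P) i i ≥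
            c * ∑ j ∈ Finset.univ.erase i, |(Pᵀ * Matrix.diagonal lam * P) i j|) →
        ((Pᵀ * Matrix.diagonal (fun j => lam j ^ s) * P) i i ≥
            Ct * ∑ j ∈ Finset.univ.erase i,
              |(Pᵀ * Matrix.diagonal (fun j => lam j ^ s) * P) i j|) := by
  obtain ⟨K, hK, hLip⟩ := Real.exists_abs_rpow_sub_rpow_le s (b := a₄) ha₃
  set m := min (a₃ ^ s) (a₄ ^ s)
  have ha₄ : 0 < a₄ := ha₃.trans_le ha
  have hm : 0 < m := lt_min (Real.rpow_pos_of_pos ha₃ s) (Real.rpow_pos_of_pos ha₄ s)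
  have hbound (x : ℝ) (hx : x ∈ Set.Icc a₃ a₄) : x ^ s ∈ Set.Icc m (max (a₃ ^ s) (a₄ ^ s)) := by
    have hx0 : 0 < x := ha₃.trans_le hx.1
    rcases le_total 0 s with hs | hs
    · exact ⟨min_le_of_left_le (Real.rpow_le_rpow ha₃.le hx.1 hs),
        le_max_of_le_right (Real.rpow_le_rpow hx0.le hx.2 hs)⟩
    · exact ⟨min_le_of_right_le (Real.rpow_le_rpow_of_nonpos hx0 hx.2 hs),
        le_max_of_le_left (Real.rpow_le_rpow_of_nonpos ha₃ hx.1 hs)⟩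
  set B := Ct * ((N : ℝ) ^ 2 * K)
  have hB : 0 ≤ B := by positivity
  refine ⟨B * a₄ / m + 1, by positivity, fun P hP hP' lam hlam i hdom => ?_⟩
  have hoff := Matrix.sum_abs_offDiag_comp_le hP hP' hlam hK hLip i
  rw [Fintype.card_fin] at hoff
  have hdiag := (Matrix.transpose_mul_diagonal_mul_apply_self_mem_Icc hP
    (fun k => hbound _ (hlam k)) i).1
  have hle := (Matrix.transpose_mul_diagonal_mul_apply_self_mem_Icc hP hlam i).2
  set R := ∑ j ∈ Finset.univ.erase i, |(Pᵀ * Matrix.diagonal lam * P) i j|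
  have hR : 0 ≤ R := Finset.sum_nonneg fun _ _ => abs_nonneg _
  have hBR : B * R ≤ m := by
    have h : B * a₄ / m * R ≤ a₄ := by linarith
    rw [div_mul_eq_mul_div, div_le_iff₀ hm] at h
    exact le_of_mul_le_mul_left (by linarith) ha₄
  calc _ ≤ Ct * ((N : ℝ) ^ 2 * K * R) := mul_le_mul_of_nonneg_left hoff hCt.le
    _ = B * R := by ring
    _ ≤ m := hBR
    _ ≤ _ := hdiag
end

section
/- Let η₁, η₂, η₃ ∈ (−1, 1] be real numbers satisfying η₁ + η₂η₃ ≥ 0, η₂ + η₃η₁ ≥ 0 and η₃ + η₁η₂ ≥ 0. For any u₁, u₂, u₃ ∈ ℝ define l₃ = √(e^{2u₁} + e^{2u₂} + 2η₃ e^{u₁+u₂}), l₂ = √(e^{2u₁} + e^{2u₃} + 2η₂ e^{u₁+u₃}), and l₁ = √(e^{2u₂} + e^{2u₃} + 2η₁ e^{u₂+u₃}). Then each quantity under a square root is strictly positive, and the strict triangle inequalities hold: l₁ < l₂ + l₃, l₂ < l₁ + l₃, and l₃ < l₁ + l₂. -/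
open Real

/-- The radicand of a circle-packing edge length is positive. -/
theorem circlePacking_radicand_pos {a b x : ℝ} (ha : 0 < a) (hb : 0 < b) (hx : -1 < x) :
    0 < a ^ 2 + b ^ 2 + 2 * x * (a * b) := by
  nlinarith [sq_nonneg (a - b), mul_pos (mul_pos ha hb) (neg_lt_iff_pos_add.mp hx)]

/-- Positivity of the Cayley–Menger (Heron) polynomial of a circle-packing triangle. -/
theorem circlePacking_heron_pos {a b c x y z : ℝ} (ha : 0 < a) (hb : 0 < b) (hc : 0 < c)
    (hx : -1 < x ∧ x ≤ 1) (hy : -1 < y ∧ y ≤ 1) (hz : -1 < z ∧ z ≤ 1)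
    (hxs : 0 ≤ x + y * z) (hys : 0 ≤ y + z * x) (hzs : 0 ≤ z + x * y) :
    0 < b ^ 2 * c ^ 2 * (1 - x ^ 2) + a ^ 2 * c ^ 2 * (1 - y ^ 2) + a ^ 2 * b ^ 2 * (1 - z ^ 2)
      + 2 * (a ^ 2 * b * c * (x + y * z) + a * b ^ 2 * c * (y + z * x)
        + a * b * c ^ 2 * (z + x * y)) := by
  have hsq : ∀ {t : ℝ}, -1 < t ∧ t ≤ 1 → 0 ≤ 1 - t ^ 2 := fun ht => by nlinarith [ht.1, ht.2]
  have hx' := hsq hx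
  have hy' := hsq hy
  have hz' := hsq hz
  have hsq_lt : ∀ {t : ℝ}, -1 < t ∧ t ≤ 1 → t ≠ 1 → 0 < 1 - t ^ 2 := fun ht h => by
    nlinarith [ht.1, lt_of_le_of_ne ht.2 h]
  by_cases h : x = 1 ∧ y = 1 ∧ z = 1
  · obtain ⟨rfl, rfl, rfl⟩ := h
    norm_num
    positivity
  · rw [not_and_or, not_and_or] at h
    rcases h with h | h | h
    · have := hsq_lt hx h
      positivity
    · have := hsq_lt hy h
      positivity
    · have := hsq_lt hz h
      positivity

theorem sqrt_lt_sqrt_add_sqrt {A B C : ℝ} (hB : 0 < B) (hC : 0 < C)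
    (h : (A - B - C) ^ 2 < 4 * (B * C)) : √A < √B + √C := by
  have hBC : A - B - C < 2 * (√B * √C) := by
    refine lt_of_pow_lt_pow_left₀ 2 (by positivity) ?_
    calc (A - B - C) ^ 2 < 4 * (B * C) := h
      _ = (2 * (√B * √C)) ^ 2 := by
        rw [mul_pow, mul_pow, sq_sqrt hB.le, sq_sqrt hC.le]
        ring
  rw [sqrt_lt' (by positivity), add_sq, sq_sqrt hB.le, sq_sqrt hC.le]
  linarith

/-- for weights `η₁, η₂, η₃ ∈ (−1,1]` satisfying the structure
condition, the Euclidean circle-packing edge lengths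
`l₃ = √(e^{2u₁}+e^{2u₂}+2η₃e^{u₁+u₂})` etc. have strictly positive radicands
and satisfy the strict triangle inequalities. -/
theorem stmt5 (η₁ η₂ η₃ : ℝ)
    (hη₁ : -1 < η₁ ∧ η₁ ≤ 1) (hη₂ : -1 < η₂ ∧ η₂ ≤ 1) (hη₃ : -1 < η₃ ∧ η₃ ≤ 1)
    (hs₁ : 0 ≤ η₁ + η₂ * η₃) (hs₂ : 0 ≤ η₂ + η₃ * η₁) (hs₃ : 0 ≤ η₃ + η₁ * η₂)
    (u₁ u₂ u₃ : ℝ) :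
    0 < exp (2 * u₂) + exp (2 * u₃) + 2 * η₁ * exp (u₂ + u₃) ∧
    0 < exp (2 * u₁) + exp (2 * u₃) + 2 * η₂ * exp (u₁ + u₃) ∧
    0 < exp (2 * u₁) + exp (2 * u₂) + 2 * η₃ * exp (u₁ + u₂) ∧
    Real.sqrt (exp (2 * u₂) + exp (2 * u₃) + 2 * η₁ * exp (u₂ + u₃)) <
      Real.sqrt (exp (2 * u₁) + exp (2 * u₃) + 2 * η₂ * exp (u₁ + u₃)) +
      Real.sqrt (exp (2 * u₁) + exp (2 * u₂) + 2 * η₃ * exp (u₁ + u₂)) ∧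
    Real.sqrt (exp (2 * u₁) + exp (2 * u₃) + 2 * η₂ * exp (u₁ + u₃)) <
      Real.sqrt (exp (2 * u₂) + exp (2 * u₃) + 2 * η₁ * exp (u₂ + u₃)) +
      Real.sqrt (exp (2 * u₁) + exp (2 * u₂) + 2 * η₃ * exp (u₁ + u₂)) ∧
    Real.sqrt (exp (2 * u₁) + exp (2 * u₂) + 2 * η₃ * exp (u₁ + u₂)) <
      Real.sqrt (exp (2 * u₂) + exp (2 * u₃) + 2 * η₁ * exp (u₂ + u₃)) +
      Real.sqrt (exp (2 * u₁) + exp (2 * u₃) + 2 * η₂ * exp (u₁ + u₃)) := by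
  have hexp : ∀ u : ℝ, exp (2 * u) = exp u ^ 2 := fun u => by rw [← exp_nat_mul]; norm_num
  simp only [hexp, exp_add]
  have h₁ := circlePacking_radicand_pos (exp_pos u₂) (exp_pos u₃) hη₁.1
  have h₂ := circlePacking_radicand_pos (exp_pos u₁) (exp_pos u₃) hη₂.1
  have h₃ := circlePacking_radicand_pos (exp_pos u₁) (exp_pos u₂) hη₃.1
  have hpos := circlePacking_heron_pos (exp_pos u₁) (exp_pos u₂) (exp_pos u₃)
    hη₁ hη₂ hη₃ hs₁ hs₂ hs₃
  refine ⟨h₁, h₂, h₃, sqrt_lt_sqrt_add_sqrt h₂ h₃ ?_, sqrt_lt_sqrt_add_sqrt h₁ h₃ ?_,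
    sqrt_lt_sqrt_add_sqrt h₁ h₂ ?_⟩ <;> linarith
end

section
/- Let η₁₂, η₁₃, η₂₃ be real numbers and r₁, r₂, r₃ be real numbers. Write C_m = cosh r_m, S_m = sinh r_m, and set x_{ij} = C_iC_j + η_{ij}S_iS_j for each pair i < j, and γ₁₂₃ = η₂₃ + η₁₂η₁₃, γ₂₁₃ = η₁₃ + η₁₂η₂₃, γ₃₁₂ = η₁₂ + η₁₃η₂₃. Then 1 + 2·x₁₂·x₁₃·x₂₃ − x₁₂² − x₁₃² − x₂₃² = 2S₁²S₂²S₃²(1 + η₁₂η₁₃η₂₃) + S₁²S₂²(1 − η₁₂²) + S₁²S₃²(1 − η₁₃²) + S₂²S₃²(1 − η₂₃²) + 2C₂C₃S₁²S₂S₃·γ₁₂₃ + 2C₁C₃S₁S₂²S₃·γ₂₁₃ + 2C₁C₂S₁S₂S₃²·γ₃₁₂. -/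
open Real

/-- the polynomial identity expanding
`1 + 2 x₁₂ x₁₃ x₂₃ − x₁₂² − x₁₃² − x₂₃²` for
`x_{ij} = Cᵢ Cⱼ + η_{ij} Sᵢ Sⱼ` (`C = cosh r`, `S = sinh r`) in terms of
`S₁, S₂, S₃, C₁, C₂, C₃` and the weights, valid for all real values. -/
theorem stmt10 (η₁₂ η₁₃ η₂₃ r₁ r₂ r₃ : ℝ) :
    1 + 2 * (cosh r₁ * cosh r₂ + η₁₂ * sinh r₁ * sinh r₂) *
          (cosh r₁ * cosh r₃ + η₁₃ * sinh r₁ * sinh r₃) *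
          (cosh r₂ * cosh r₃ + η₂₃ * sinh r₂ * sinh r₃) -
        (cosh r₁ * cosh r₂ + η₁₂ * sinh r₁ * sinh r₂) ^ 2 -
        (cosh r₁ * cosh r₃ + η₁₃ * sinh r₁ * sinh r₃) ^ 2 -
        (cosh r₂ * cosh r₃ + η₂₃ * sinh r₂ * sinh r₃) ^ 2 =
      2 * sinh r₁ ^ 2 * sinh r₂ ^ 2 * sinh r₃ ^ 2 * (1 + η₁₂ * η₁₃ * η₂₃) +
        sinh r₁ ^ 2 * sinh r₂ ^ 2 * (1 - η₁₂ ^ 2) +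
        sinh r₁ ^ 2 * sinh r₃ ^ 2 * (1 - η₁₃ ^ 2) +
        sinh r₂ ^ 2 * sinh r₃ ^ 2 * (1 - η₂₃ ^ 2) +
        2 * cosh r₂ * cosh r₃ * sinh r₁ ^ 2 * sinh r₂ * sinh r₃ * (η₂₃ + η₁₂ * η₁₃) +
        2 * cosh r₁ * cosh r₃ * sinh r₁ * sinh r₂ ^ 2 * sinh r₃ * (η₁₃ + η₁₂ * η₂₃) +
        2 * cosh r₁ * cosh r₂ * sinh r₁ * sinh r₂ * sinh r₃ ^ 2 * (η₁₂ + η₁₃ * η₂₃) := by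
  grind [cosh_sq r₁, cosh_sq r₂, cosh_sq r₃]
end

section
/- Let η₁₂, η₁₃, η₂₃ ∈ (−1, 1] satisfy γ₁₂₃ = η₂₃ + η₁₂η₁₃ ≥ 0, γ₂₁₃ = η₁₃ + η₁₂η₂₃ ≥ 0, γ₃₁₂ = η₁₂ + η₁₃η₂₃ ≥ 0, and let R > 0. There exist constants c₁ > 0 and c₂ > 0 depending only on η₁₂, η₁₃, η₂₃ and R such that for all r₁, r₂, r₃ ≥ R, c₁ ≤ e^{−2(r₁+r₂+r₃)} · (1 + 2·x₁₂·x₁₃·x₂₃ − x₁₂² − x₁₃² − x₂₃²) ≤ c₂, where x_{ij} = cosh r_i cosh r_j + η_{ij} sinh r_i sinh r_j. -/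
open Real

lemma one_add_mul_mul_pos {a b c : ℝ} (ha : -1 < a ∧ a ≤ 1) (hb : -1 < b ∧ b ≤ 1)
    (hc : -1 < c ∧ c ≤ 1) : 0 < 1 + a * b * c := by
  obtain ⟨ha, ha'⟩ := ha
  obtain ⟨hb, hb'⟩ := hb
  have hab : -1 < a * b := by
    rcases le_total 0 b with h | h <;> nlinarith
  have hab' : a * b ≤ 1 := by
    rcases le_total 0 b with h | h <;> nlinarith
  obtain ⟨hc, hc'⟩ := hc
  rcases le_total 0 c with h | h <;> nlinarith

/-- The determinant `1 + 2 x₁₂ x₁₃ x₂₃ - x₁₂² - x₁₃² - x₂₃²` expanded in terms of the radii; under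
the structure condition every summand is nonnegative. -/
lemma det_eq_of_sq_eq {C₁ C₂ C₃ S₁ S₂ S₃ : ℝ} (a b c : ℝ) (h₁ : C₁ ^ 2 = S₁ ^ 2 + 1)
    (h₂ : C₂ ^ 2 = S₂ ^ 2 + 1) (h₃ : C₃ ^ 2 = S₃ ^ 2 + 1) :
    1 + 2 * (C₁ * C₂ + a * S₁ * S₂) * (C₁ * C₃ + b * S₁ * S₃) * (C₂ * C₃ + c * S₂ * S₃) -
        (C₁ * C₂ + a * S₁ * S₂) ^ 2 - (C₁ * C₃ + b * S₁ * S₃) ^ 2 -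
        (C₂ * C₃ + c * S₂ * S₃) ^ 2 =
      2 * (1 + a * b * c) * (S₁ * S₂ * S₃) ^ 2 +
        (1 - a ^ 2) * (S₁ * S₂) ^ 2 + (1 - b ^ 2) * (S₁ * S₃) ^ 2 + (1 - c ^ 2) * (S₂ * S₃) ^ 2 +
        2 * (c + a * b) * (C₂ * C₃ * S₂ * S₃ * S₁ ^ 2) +
        2 * (b + a * c) * (C₁ * C₃ * S₁ * S₃ * S₂ ^ 2) +
        2 * (a + b * c) * (C₁ * C₂ * S₁ * S₂ * S₃ ^ 2) := by
  have expand :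
      1 + 2 * (C₁ * C₂ + a * S₁ * S₂) * (C₁ * C₃ + b * S₁ * S₃) * (C₂ * C₃ + c * S₂ * S₃) -
        (C₁ * C₂ + a * S₁ * S₂) ^ 2 - (C₁ * C₃ + b * S₁ * S₃) ^ 2 -
        (C₂ * C₃ + c * S₂ * S₃) ^ 2 =
      1 + 2 * C₁ ^ 2 * C₂ ^ 2 * C₃ ^ 2 + 2 * a * b * c * (S₁ * S₂ * S₃) ^ 2 +
        2 * a * S₁ * S₂ * C₁ * C₂ * (C₃ ^ 2 - 1) + 2 * b * S₁ * S₃ * C₁ * C₃ * (C₂ ^ 2 - 1) +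
        2 * c * S₂ * S₃ * C₂ * C₃ * (C₁ ^ 2 - 1) +
        2 * a * b * S₁ ^ 2 * S₂ * S₃ * C₂ * C₃ + 2 * a * c * S₁ * S₂ ^ 2 * S₃ * C₁ * C₃ +
        2 * b * c * S₁ * S₂ * S₃ ^ 2 * C₁ * C₂ -
        C₁ ^ 2 * C₂ ^ 2 - C₁ ^ 2 * C₃ ^ 2 - C₂ ^ 2 * C₃ ^ 2 -
        a ^ 2 * (S₁ * S₂) ^ 2 - b ^ 2 * (S₁ * S₃) ^ 2 - c ^ 2 * (S₂ * S₃) ^ 2 := by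
    ring
  rw [expand, h₁, h₂, h₃]
  ring

lemma edge_cosh_nonneg {η : ℝ} (hη : -1 < η) {r s : ℝ} (hr : 0 ≤ r) (hs : 0 ≤ s) :
    0 ≤ cosh r * cosh s + η * sinh r * sinh s := by
  have h : 0 ≤ (1 + η) * (sinh r * sinh s) :=
    mul_nonneg (by linarith) (mul_nonneg (sinh_nonneg_iff.2 hr) (sinh_nonneg_iff.2 hs))
  linarith [cosh_sub r s, cosh_pos (r - s)]

lemma edge_cosh_le {η : ℝ} (hη : η ≤ 1) {r s : ℝ} (hr : 0 ≤ r) (hs : 0 ≤ s) :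
    cosh r * cosh s + η * sinh r * sinh s ≤ exp r * exp s := by
  have h : 0 ≤ (1 - η) * (sinh r * sinh s) :=
    mul_nonneg (by linarith) (mul_nonneg (sinh_nonneg_iff.2 hr) (sinh_nonneg_iff.2 hs))
  have hsinh : 0 ≤ sinh (r + s) := sinh_nonneg_iff.2 (by linarith)
  rw [← exp_add]
  linarith [cosh_add r s, cosh_add_sinh (r + s)]

lemma le_exp_neg_mul_sinh {R r : ℝ} (h : R ≤ r) :
    (1 - exp (-2 * R)) / 2 ≤ exp (-r) * sinh r := by
  have h₁ : exp (-r) * sinh r = (1 - exp (-2 * r)) / 2 := by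
    rw [sinh_eq, show -2 * r = -r + -r by ring, exp_add, exp_neg]
    field_simp
  have h₂ : exp (-2 * r) ≤ exp (-2 * R) := exp_le_exp.2 (by linarith)
  linarith

lemma exp_neg_two_mul_add (x y z : ℝ) :
    exp (-2 * (x + y + z)) = (exp (-x) * exp (-y) * exp (-z)) ^ 2 := by
  rw [← exp_add, ← exp_add, ← exp_nat_mul]
  congr 1
  push_cast
  ring

/-- for weights `η_{ij} ∈ (−1,1]` satisfying the structure
condition and `R > 0`, there are constants `c₁, c₂ > 0` depending only on the
weights and `R` such that for all radii `r₁, r₂, r₃ ≥ R`,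
`c₁ ≤ e^{−2(r₁+r₂+r₃)}·(1 + 2 x₁₂ x₁₃ x₂₃ − x₁₂² − x₁₃² − x₂₃²) ≤ c₂`,
where `x_{ij} = cosh rᵢ cosh rⱼ + η_{ij} sinh rᵢ sinh rⱼ`. -/
theorem stmt12 (η₁₂ η₁₃ η₂₃ : ℝ)
    (hη₁₂ : -1 < η₁₂ ∧ η₁₂ ≤ 1) (hη₁₃ : -1 < η₁₃ ∧ η₁₃ ≤ 1) (hη₂₃ : -1 < η₂₃ ∧ η₂₃ ≤ 1)
    (hγ₁ : 0 ≤ η₂₃ + η₁₂ * η₁₃) (hγ₂ : 0 ≤ η₁₃ + η₁₂ * η₂₃) (hγ₃ : 0 ≤ η₁₂ + η₁₃ * η₂₃)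
    (R : ℝ) (hR : 0 < R) :
    ∃ c₁ c₂ : ℝ, 0 < c₁ ∧ 0 < c₂ ∧
      ∀ r₁ r₂ r₃ : ℝ, R ≤ r₁ → R ≤ r₂ → R ≤ r₃ →
        c₁ ≤ exp (-2 * (r₁ + r₂ + r₃)) *
            (1 + 2 * (cosh r₁ * cosh r₂ + η₁₂ * sinh r₁ * sinh r₂) *
                  (cosh r₁ * cosh r₃ + η₁₃ * sinh r₁ * sinh r₃) *
                  (cosh r₂ * cosh r₃ + η₂₃ * sinh r₂ * sinh r₃) -
                (cosh r₁ * cosh r₂ + η₁₂ * sinh r₁ * sinh r₂) ^ 2 -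
                (cosh r₁ * cosh r₃ + η₁₃ * sinh r₁ * sinh r₃) ^ 2 -
                (cosh r₂ * cosh r₃ + η₂₃ * sinh r₂ * sinh r₃) ^ 2) ∧
        exp (-2 * (r₁ + r₂ + r₃)) *
            (1 + 2 * (cosh r₁ * cosh r₂ + η₁₂ * sinh r₁ * sinh r₂) *
                  (cosh r₁ * cosh r₃ + η₁₃ * sinh r₁ * sinh r₃) *
                  (cosh r₂ * cosh r₃ + η₂₃ * sinh r₂ * sinh r₃) -
                (cosh r₁ * cosh r₂ + η₁₂ * sinh r₁ * sinh r₂) ^ 2 -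
                (cosh r₁ * cosh r₃ + η₁₃ * sinh r₁ * sinh r₃) ^ 2 -
                (cosh r₂ * cosh r₃ + η₂₃ * sinh r₂ * sinh r₃) ^ 2) ≤ c₂ := by
  set k := (1 - exp (-2 * R)) / 2 with hk
  have hk_pos : 0 < k := by
    have : exp (-2 * R) < 1 := exp_lt_one_iff.2 (by linarith)
    linarith
  have hη := one_add_mul_mul_pos hη₁₂ hη₁₃ hη₂₃
  refine ⟨2 * (1 + η₁₂ * η₁₃ * η₂₃) * (k * k * k) ^ 2, 3, by positivity, by norm_num, ?_⟩
  intro r₁ r₂ r₃ h₁ h₂ h₃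
  have p₁ : 0 ≤ r₁ := hR.le.trans h₁
  have p₂ : 0 ≤ r₂ := hR.le.trans h₂
  have p₃ : 0 ≤ r₃ := hR.le.trans h₃
  constructor
  · have s₁ := sinh_nonneg_iff.2 p₁
    have s₂ := sinh_nonneg_iff.2 p₂
    have s₃ := sinh_nonneg_iff.2 p₃
    have q₁₂ : 0 ≤ 1 - η₁₂ ^ 2 := by nlinarith
    have q₁₃ : 0 ≤ 1 - η₁₃ ^ 2 := by nlinarith
    have q₂₃ : 0 ≤ 1 - η₂₃ ^ 2 := by nlinarith
    have c₁ := (cosh_pos r₁).le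
    have c₂ := (cosh_pos r₂).le
    have c₃ := (cosh_pos r₃).le
    calc 2 * (1 + η₁₂ * η₁₃ * η₂₃) * (k * k * k) ^ 2
        ≤ 2 * (1 + η₁₂ * η₁₃ * η₂₃) *
            ((exp (-r₁) * sinh r₁) * (exp (-r₂) * sinh r₂) * (exp (-r₃) * sinh r₃)) ^ 2 := by
          gcongr <;> exact le_exp_neg_mul_sinh ‹_›
      _ = exp (-2 * (r₁ + r₂ + r₃)) *
            (2 * (1 + η₁₂ * η₁₃ * η₂₃) * (sinh r₁ * sinh r₂ * sinh r₃) ^ 2) := by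
          rw [exp_neg_two_mul_add]
          ring
      _ ≤ _ := by
          rw [det_eq_of_sq_eq _ _ _ (cosh_sq r₁) (cosh_sq r₂) (cosh_sq r₃)]
          refine mul_le_mul_of_nonneg_left ?_ (exp_pos _).le
          simp only [add_assoc]
          exact le_add_of_nonneg_right (by positivity)
  · have hE : exp (-2 * (r₁ + r₂ + r₃)) * (exp r₁ * exp r₂ * exp r₃) ^ 2 = 1 := by
      rw [exp_neg_two_mul_add, exp_neg, exp_neg, exp_neg]
      field_simp
    have hE₁ : exp (-2 * (r₁ + r₂ + r₃)) ≤ 1 := exp_le_one_iff.2 (by linarith)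
    have hx : (cosh r₁ * cosh r₂ + η₁₂ * sinh r₁ * sinh r₂) *
        (cosh r₁ * cosh r₃ + η₁₃ * sinh r₁ * sinh r₃) *
        (cosh r₂ * cosh r₃ + η₂₃ * sinh r₂ * sinh r₃) ≤
        (exp r₁ * exp r₂) * (exp r₁ * exp r₃) * (exp r₂ * exp r₃) := by
      have n₁₃ := edge_cosh_nonneg hη₁₃.1 p₁ p₃
      have n₂₃ := edge_cosh_nonneg hη₂₃.1 p₂ p₃
      exact mul_le_mul (mul_le_mul (edge_cosh_le hη₁₂.2 p₁ p₂) (edge_cosh_le hη₁₃.2 p₁ p₃) n₁₃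
        (by positivity)) (edge_cosh_le hη₂₃.2 p₂ p₃) n₂₃ (by positivity)
    calc _ ≤ exp (-2 * (r₁ + r₂ + r₃)) * (1 + 2 * (exp r₁ * exp r₂ * exp r₃) ^ 2) := by
          refine mul_le_mul_of_nonneg_left ?_ (exp_pos _).le
          linarith [sq_nonneg (cosh r₁ * cosh r₂ + η₁₂ * sinh r₁ * sinh r₂),
            sq_nonneg (cosh r₁ * cosh r₃ + η₁₃ * sinh r₁ * sinh r₃),
            sq_nonneg (cosh r₂ * cosh r₃ + η₂₃ * sinh r₂ * sinh r₃)]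
      _ ≤ 3 := by linarith
end

section
/- Let N ≥ 1 and C₀ > 0. Let A be a real diagonal N×N matrix with nonnegative diagonal entries, and let B be a real symmetric N×N matrix with B_{ij} ≤ 0 for all i ≠ j and B_{ii} = −∑_{j ≠ i} B_{ij} for every i (so each row of B sums to zero). Assume A_{ii} ≥ C₀ · ∑_{j ≠ i} (−B_{ij}) for every i. Then for every x ∈ ℝᴺ, xᵀ A x ≤ xᵀ (A + B) x ≤ (1 + 3/C₀) · xᵀ A x. -/
open Matrix

/-- If all row and column sums of `B` vanish, only the cross terms of `∑ B i j (x i + c x j)²`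
survive. -/
lemma sum_sum_mul_add_sq_of_sum_eq_zero {ι : Type*} [Fintype ι] (B : Matrix ι ι ℝ)
    (hrow : ∀ i, ∑ j, B i j = 0) (hcol : ∀ j, ∑ i, B i j = 0) (c : ℝ) (x : ι → ℝ) :
    ∑ i, ∑ j, B i j * (x i + c * x j) ^ 2 = 2 * c * (x ⬝ᵥ B.mulVec x) := by
  have h₁ : ∑ i, ∑ j, B i j * x i ^ 2 = 0 := by
    simp [← Finset.sum_mul, hrow]
  have h₂ : ∑ i, ∑ j, B i j * x j ^ 2 = 0 := by
    rw [Finset.sum_comm]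
    simp [← Finset.sum_mul, hcol]
  calc ∑ i, ∑ j, B i j * (x i + c * x j) ^ 2
      = ∑ i, ∑ j, B i j * x i ^ 2 + 2 * c * ∑ i, ∑ j, x i * (B i j * x j)
          + c ^ 2 * ∑ i, ∑ j, B i j * x j ^ 2 := by
        simp only [Finset.mul_sum, ← Finset.sum_add_distrib]
        exact Finset.sum_congr rfl fun i _ => Finset.sum_congr rfl fun j _ => by ring
    _ = 2 * c * (x ⬝ᵥ B.mulVec x) := by
        simp only [h₁, h₂, dotProduct, mulVec, Finset.mul_sum, mul_zero, zero_add, add_zero]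

/-- A matrix with nonpositive off-diagonal entries and vanishing row and column sums has a
nonnegative quadratic form. -/
lemma dotProduct_mulVec_nonneg_of_sum_eq_zero {ι : Type*} [Fintype ι] (B : Matrix ι ι ℝ)
    (hrow : ∀ i, ∑ j, B i j = 0) (hcol : ∀ j, ∑ i, B i j = 0)
    (hoff : ∀ i j, i ≠ j → B i j ≤ 0) (x : ι → ℝ) :
    0 ≤ x ⬝ᵥ B.mulVec x := by
  have key := sum_sum_mul_add_sq_of_sum_eq_zero B hrow hcol (-1) x
  have hle : ∑ i, ∑ j, B i j * (x i + -1 * x j) ^ 2 ≤ 0 := by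
    refine Finset.sum_nonpos fun i _ => Finset.sum_nonpos fun j _ => ?_
    rcases eq_or_ne i j with rfl | hij
    · simp
    · exact mul_nonpos_of_nonpos_of_nonneg (hoff i j hij) (sq_nonneg _)
  linarith

/-- The quadratic form of a matrix with nonpositive off-diagonal entries and vanishing row and
column sums is at most twice that of its diagonal part. -/
lemma dotProduct_mulVec_le_two_mul_sum_diag {ι : Type*} [Fintype ι] (B : Matrix ι ι ℝ)
    (hrow : ∀ i, ∑ j, B i j = 0) (hcol : ∀ j, ∑ i, B i j = 0)
    (hoff : ∀ i j, i ≠ j → B i j ≤ 0) (x : ι → ℝ) :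
    x ⬝ᵥ B.mulVec x ≤ 2 * ∑ i, B i i * x i ^ 2 := by
  classical
  have key := sum_sum_mul_add_sq_of_sum_eq_zero B hrow hcol 1 x
  have hle : ∑ i, ∑ j, B i j * (x i + 1 * x j) ^ 2 ≤ ∑ i, 4 * (B i i * x i ^ 2) := by
    refine Finset.sum_le_sum fun i _ => ?_
    rw [← Finset.add_sum_erase _ _ (Finset.mem_univ i)]
    have : ∑ j ∈ Finset.univ.erase i, B i j * (x i + 1 * x j) ^ 2 ≤ 0 :=
      Finset.sum_nonpos fun j hj => mul_nonpos_of_nonpos_of_nonneg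
        (hoff i j (Finset.ne_of_mem_erase hj).symm) (sq_nonneg _)
    linarith
  rw [← Finset.mul_sum] at hle
  linarith

/-- Let `A = diag(d)` with `d ≥ 0`, and `B` symmetric with
nonpositive off-diagonal entries and zero row sums. If
`A_{ii} ≥ C₀·∑_{j≠i}(−B_{ij})` for every `i`, then for every `x`,
`xᵀAx ≤ xᵀ(A+B)x ≤ (1 + 3/C₀)·xᵀAx`. -/
theorem stmt14 (N : ℕ) (hN : 1 ≤ N) (C₀ : ℝ) (hC₀ : 0 < C₀)
    (d : Fin N → ℝ) (hd : ∀ i, 0 ≤ d i)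
    (B : Matrix (Fin N) (Fin N) ℝ) (hBsymm : B.IsSymm)
    (hBoff : ∀ i j, i ≠ j → B i j ≤ 0)
    (hBrow : ∀ i, B i i = -∑ j ∈ Finset.univ.erase i, B i j)
    (hdom : ∀ i, C₀ * ∑ j ∈ Finset.univ.erase i, (-B i j) ≤ d i) :
    ∀ x : Fin N → ℝ,
      x ⬝ᵥ (Matrix.diagonal d).mulVec x ≤ x ⬝ᵥ (Matrix.diagonal d + B).mulVec x ∧
      x ⬝ᵥ (Matrix.diagonal d + B).mulVec x ≤
        (1 + 3 / C₀) * (x ⬝ᵥ (Matrix.diagonal d).mulVec x) := by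
  intro x
  have hrow : ∀ i, ∑ j, B i j = 0 := fun i => by
    rw [← Finset.add_sum_erase _ _ (Finset.mem_univ i), hBrow i, neg_add_cancel]
  have hcol : ∀ j, ∑ i, B i j = 0 := fun j => by
    simpa only [hBsymm.apply] using hrow j
  have hdiag : ∀ i, B i i ≤ d i / C₀ := fun i => by
    rw [le_div_iff₀' hC₀, hBrow i, ← Finset.sum_neg_distrib]
    exact hdom i
  have hA : x ⬝ᵥ (Matrix.diagonal d).mulVec x = ∑ i, d i * x i ^ 2 := by
    simp only [dotProduct, mulVec_diagonal]
    exact Finset.sum_congr rfl fun i _ => by ring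
  have hA_nonneg : 0 ≤ (∑ i, d i * x i ^ 2) / C₀ :=
    div_nonneg (Finset.sum_nonneg fun i _ => mul_nonneg (hd i) (sq_nonneg _)) hC₀.le
  have hB_diag : ∑ i, B i i * x i ^ 2 ≤ (∑ i, d i * x i ^ 2) / C₀ := by
    rw [Finset.sum_div]
    refine Finset.sum_le_sum fun i _ => ?_
    rw [mul_div_right_comm]
    exact mul_le_mul_of_nonneg_right (hdiag i) (sq_nonneg _)
  have hlower := dotProduct_mulVec_nonneg_of_sum_eq_zero B hrow hcol hBoff x
  have hupper := dotProduct_mulVec_le_two_mul_sum_diag B hrow hcol hBoff x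
  rw [add_mulVec, dotProduct_add, hA]
  refine ⟨by linarith, ?_⟩
  have hexpand : (1 + 3 / C₀) * ∑ i, d i * x i ^ 2
      = ∑ i, d i * x i ^ 2 + 3 * ((∑ i, d i * x i ^ 2) / C₀) := by ring
  linarith
end
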